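/- Let 𝒜 be a semi-abelian category. Consider a commutative diagram whose two rows are short exact sequences, 0→K'→X'→Y'→0 (with kernel k': K'→X' and regular epimorphism f': X'→Y') and 0→K→X→Y→0 (with kernel k: K→X and regular epimorphism f: X→Y), together with vertical morphisms u: K'→K, v: X'→X, w: Y'→Y satisfying v∘k' = k∘u and w∘f' = f∘v. If w is an isomorphism and u is a regular epimorphism, then the left-hand square (the commutative square v∘k' = k∘u) is a pushout. -/

import Mathlib

open CategoryTheory CategoryTheory.Limits

universe v u

section Defs

variable {C : Type u} [Category.{v} C]

/-- A finitely complete category is protomodular if, for every commutative diagram of two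
adjacent commutative squares in which the middle vertical morphism is a split epimorphism,
whenever the left-hand square and the outer rectangle are pullbacks, so is the right-hand
square. -/
def Protomodular (C : Type u) [Category.{v} C] : Prop :=
  ∀ ⦃A B D A' B' D' : C⦄ (f : A ⟶ B) (g : B ⟶ D)
    (f' : A' ⟶ B') (g' : B' ⟶ D')
    (a : A ⟶ A') (b : B ⟶ B') (d : D ⟶ D'),
    g ≫ d = b ≫ g' →
    IsSplitEpi b →
    IsPullback f a b f' →
    IsPullback (f ≫ g) a d (f' ≫ g') →
    IsPullback g b d g'

variable [HasZeroMorphisms C] [HasFiniteLimits C]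

/-- Two coterminal morphisms `k`, `k'` cooperate (commute in the sense of Huq) when there is
a morphism `φ : K ⨯ K' ⟶ X` restricting to `k` and `k'` along `(1,0)` and `(0,1)`. -/
def Cooperate {K K' X : C} (k : K ⟶ X) (k' : K' ⟶ X) : Prop :=
  ∃ φ : K ⨯ K' ⟶ X, prod.lift (𝟙 K) 0 ≫ φ = k ∧ prod.lift 0 (𝟙 K') ≫ φ = k'

/-- A morphism is central in the sense of Huq when it cooperates with the identity. -/
def HuqCentral {K X : C} (k : K ⟶ X) : Prop :=
  Cooperate k (𝟙 X)

/-- An object is abelian when its identity cooperates with itself. -/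
def IsAbelianObj (A : C) : Prop :=
  Cooperate (𝟙 A) (𝟙 A)

/-- `k` is a kernel of `f`. -/
def IsKernelOf {K X Y : C} (k : K ⟶ X) (f : X ⟶ Y) : Prop :=
  ∃ w : k ≫ f = 0, Nonempty (IsLimit (KernelFork.ofι k w))

/-- A central extension is a regular epimorphism whose kernel is Huq-central. -/
def IsCentralExt {X Y : C} (f : X ⟶ Y) : Prop :=
  Nonempty (RegularEpi f) ∧ HuqCentral (kernel.ι f)

/-- A normal monomorphism: a morphism that is a kernel of some morphism. -/
def IsNormalMonoP {K X : C} (m : K ⟶ X) : Prop :=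
  ∃ (Z : C) (g : X ⟶ Z), IsKernelOf m g

/-- `(p₁, p₂) : R ↣ X ⨯ X` is an internal equivalence relation. -/
structure IsEquivRelation {R X : C} (p₁ p₂ : R ⟶ X) : Prop where
  mono : Mono (prod.lift p₁ p₂)
  refl : ∃ d : X ⟶ R, d ≫ p₁ = 𝟙 X ∧ d ≫ p₂ = 𝟙 X
  symm : ∃ s : R ⟶ R, s ≫ p₁ = p₂ ∧ s ≫ p₂ = p₁
  trans : ∃ t : pullback p₂ p₁ ⟶ R,
    t ≫ p₁ = pullback.fst p₂ p₁ ≫ p₁ ∧ t ≫ p₂ = pullback.snd p₂ p₁ ≫ p₂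

end Defs

/-- A semi-abelian category: pointed, Barr-exact (regular with effective equivalence
relations), protomodular and with binary coproducts. -/
class SemiAbelian (C : Type u) [Category.{v} C] [HasZeroMorphisms C] [HasZeroObject C]
    [HasFiniteLimits C] [HasBinaryCoproducts C] : Prop where
  /-- Every kernel pair has a coequalizer. -/
  hasCoeqOfKernelPair : ∀ {X Y : C} (f : X ⟶ Y),
    HasCoequalizer (pullback.fst f f) (pullback.snd f f)
  /-- Regular epimorphisms are stable under pullback. -/
  regEpiPullbackStable : ∀ {X Y Z : C} (f : X ⟶ Z) (g : Y ⟶ Z),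
    Nonempty (RegularEpi g) → Nonempty (RegularEpi (pullback.fst f g))
  /-- Every internal equivalence relation is effective, i.e. a kernel pair. -/
  equivRelationEffective : ∀ {R X : C} (p₁ p₂ : R ⟶ X), IsEquivRelation p₁ p₂ →
    ∃ (Y : C) (f : X ⟶ Y), IsKernelPair f p₁ p₂
  /-- The category is protomodular. -/
  protomodular : Protomodular C

section Helpers

variable {C : Type u} [Category.{v} C] [HasZeroMorphisms C]

theorem IsKernelOf.exists_lift {K X Y : C} {k : K ⟶ X} {f : X ⟶ Y} (h : IsKernelOf k f)
    {T : C} (t : T ⟶ X) (ht : t ≫ f = 0) : ∃ l : T ⟶ K, l ≫ k = t := by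
  obtain ⟨_, ⟨hl⟩⟩ := h
  exact ⟨_, (KernelFork.IsLimit.lift' hl t ht).2⟩

theorem IsKernelOf.mono {K X Y : C} {k : K ⟶ X} {f : X ⟶ Y} (h : IsKernelOf k f) : Mono k := by
  obtain ⟨_, ⟨hl⟩⟩ := h
  exact mono_of_isLimit_fork hl

theorem isKernelOf_of_exists_lift {K X Y : C} {k : K ⟶ X} {f : X ⟶ Y} [Mono k] (w : k ≫ f = 0)
    (h : ∀ ⦃T : C⦄ (t : T ⟶ X), t ≫ f = 0 → ∃ l : T ⟶ K, l ≫ k = t) : IsKernelOf k f := by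
  choose l hl using h
  exact ⟨w, ⟨KernelFork.IsLimit.ofι' k w fun t ht => ⟨l t ht, hl t ht⟩⟩⟩

/-- A kernel of `f` induces a kernel of each pullback of `f`. -/
theorem IsKernelOf.lift_zero [HasPullbacks C] {K X Y Z : C} {k : K ⟶ X} {f : X ⟶ Y}
    (h : IsKernelOf k f) (g : Z ⟶ Y) (w : k ≫ f = 0 ≫ g) :
    IsKernelOf (pullback.lift k 0 w) (pullback.snd f g) := by
  have : Mono k := h.mono
  have : Mono (pullback.lift k 0 w) :=
    mono_of_mono_fac (pullback.lift_fst k 0 w)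
  refine isKernelOf_of_exists_lift (pullback.lift_snd k 0 w) fun T t ht => ?_
  obtain ⟨l, hl⟩ := h.exists_lift (t ≫ pullback.fst f g) (by
    rw [Category.assoc, pullback.condition, reassoc_of% ht, zero_comp])
  refine ⟨l, pullback.hom_ext ?_ ?_⟩
  · rw [Category.assoc, pullback.lift_fst, hl]
  · rw [Category.assoc, pullback.lift_snd, comp_zero, ht]

theorem IsKernelOf.isPullback {K X Y : C} {k : K ⟶ X} {f : X ⟶ Y}
    (h : IsKernelOf k f) {Z : C} (hZ : IsZero Z) :
    IsPullback k (0 : K ⟶ Z) f (0 : Z ⟶ Y) := by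
  have : Mono k := h.mono
  refine ⟨⟨by rw [h.choose, zero_comp]⟩, ⟨PullbackCone.isLimitAux' _ fun s => ?_⟩⟩
  have hs := h.exists_lift s.fst (by rw [s.condition, comp_zero])
  exact ⟨hs.choose, hs.choose_spec, hZ.eq_of_tgt _ _,
    fun {m} hm _ => (cancel_mono k).1 (hm.trans hs.choose_spec.symm)⟩

/-- In a pointed protomodular category, the kernel and the section of a split epimorphism are
jointly extremal: a subobject containing both is the whole object. -/
theorem Protomodular.isIso_of_mono [HasZeroObject C] (hC : Protomodular C) {N E R B : C}
    (m : E ⟶ R) [Mono m] (b : R ⟶ B) (n : N ⟶ E) (s : B ⟶ E) (hs : s ≫ m ≫ b = 𝟙 B)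
    (hn : IsKernelOf (n ≫ m) b) : IsIso m := by
  have hn' : IsKernelOf n (m ≫ b) := by
    have := hn.mono
    have : Mono n := mono_of_mono n m
    refine isKernelOf_of_exists_lift (by simpa using hn.choose) fun T t ht => ?_
    obtain ⟨l, hl⟩ := hn.exists_lift (t ≫ m) (by simpa using ht)
    exact ⟨l, (cancel_mono m).1 (by simpa using hl)⟩
  obtain ⟨Z, hZ⟩ := HasZeroObject.zero (C := C)
  have h := hC n m (0 : Z ⟶ B) (𝟙 B) 0 (m ≫ b) b (by simp) ⟨⟨s, hs⟩⟩
    (hn'.isPullback hZ) (by simpa using hn.isPullback hZ)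
  exact h.isIso_fst_of_isIso

variable [HasZeroObject C] [HasFiniteLimits C] [HasBinaryCoproducts C] [SemiAbelian C]

theorem SemiAbelian.regular : Regular C where
  hasCoequalizer_of_isKernelPair {X Y Z f g₁ g₂} h := by
    have := SemiAbelian.hasCoeqOfKernelPair f
    let i : parallelPair g₁ g₂ ≅ parallelPair (pullback.fst f f) (pullback.snd f f) :=
      parallelPair.ext h.isoPullback (Iso.refl X)
        ((Category.comp_id _).trans h.isoPullback_hom_fst.symm)
        ((Category.comp_id _).trans h.isoPullback_hom_snd.symm)
    exact hasColimit_of_iso i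
  regularEpiIsStableUnderBaseChange :=
    MorphismProperty.IsStableUnderBaseChange.mk'
      (P := MorphismProperty.regularEpi C) fun _ _ _ f g _ hg =>
        ⟨SemiAbelian.regEpiPullbackStable f g hg.1⟩

/-- In a semi-abelian category, a regular epimorphism is the cokernel of its kernel. -/
theorem SemiAbelian.exists_desc {X Y Z : C} (f : X ⟶ Y) [IsRegularEpi f] (p : X ⟶ Z)
    (hp : kernel.ι f ≫ p = 0) : ∃ t : Y ⟶ Z, f ≫ t = p := by
  refine IsRegularEpi.exists_of_isKernelPair f (IsKernelPair.of_hasPullback f) p ?_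
  have hk : IsKernelOf (kernel.ι f) f := ⟨kernel.condition f, ⟨kernelIsKernel f⟩⟩
  have w : kernel.ι f ≫ f = 0 ≫ f := by simp
  let n : kernel f ⟶ equalizer (pullback.fst f f ≫ p) (pullback.snd f f ≫ p) :=
    equalizer.lift (pullback.lift (kernel.ι f) 0 w) (by
      rw [pullback.lift_fst_assoc, pullback.lift_snd_assoc, hp, zero_comp])
  let s : X ⟶ equalizer (pullback.fst f f ≫ p) (pullback.snd f f ≫ p) :=
    equalizer.lift (pullback.lift (𝟙 X) (𝟙 X) rfl) (by
      rw [pullback.lift_fst_assoc, pullback.lift_snd_assoc])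
  have := (SemiAbelian.protomodular (C := C)).isIso_of_mono
    (equalizer.ι (pullback.fst f f ≫ p) (pullback.snd f f ≫ p)) (pullback.snd f f) n s
    (by rw [equalizer.lift_ι_assoc, pullback.lift_snd]) (by simpa [n] using hk.lift_zero f w)
  exact (cancel_epi (equalizer.ι _ _)).1 (equalizer.condition _ _)

/-- In a semi-abelian category, a subobject of `X` which contains the kernel of `f : X ⟶ Y` and
which receives a morphism whose composite to `Y` is a regular epimorphism is all of `X`. -/
theorem SemiAbelian.isIso_of_mono_of_kernel_factors {K X Y I X' : C} {k : K ⟶ X} {f : X ⟶ Y}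
    (hk : IsKernelOf k f) (m : I ⟶ X) [Mono m] (l : K ⟶ I) (hl : l ≫ m = k) (e : X' ⟶ I)
    [IsRegularEpi (e ≫ m ≫ f)] : IsIso m := by
  let g := e ≫ m ≫ f
  have w : k ≫ f = 0 ≫ g := by rw [hk.choose, zero_comp]
  let m' : pullback (m ≫ f) g ⟶ pullback f g :=
    pullback.lift (pullback.fst _ _ ≫ m) (pullback.snd _ _) (by simp [pullback.condition])
  have : Mono m' := ⟨fun a b hab => by
    have h₁ := hab =≫ pullback.fst f g
    have h₂ := hab =≫ pullback.snd f g
    simp only [m', Category.assoc, pullback.lift_fst, pullback.lift_snd] at h₁ h₂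
    exact pullback.hom_ext ((cancel_mono m).1 (by simpa using h₁)) h₂⟩
  let n : K ⟶ pullback (m ≫ f) g := pullback.lift l 0 (by rw [← w, reassoc_of% hl])
  let s : X' ⟶ pullback (m ≫ f) g := pullback.lift e (𝟙 X') (by simp [g])
  have hn : n ≫ m' = pullback.lift k 0 w := pullback.hom_ext 
    (by simp only [n, m', Category.assoc, pullback.lift_fst, pullback.lift_fst_assoc, hl])
    (by simp only [n, m', Category.assoc, pullback.lift_snd])
  have : IsIso m' := (SemiAbelian.protomodular (C := C)).isIso_of_mono m' (pullback.snd f g) n s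
    (by simp only [s, m', pullback.lift_snd]) (by rw [hn]; exact hk.lift_zero g w)
  have : IsRegularEpi (pullback.fst f g) :=
    ⟨SemiAbelian.regEpiPullbackStable f g ⟨IsRegularEpi.getStruct (e ≫ m ≫ f)⟩⟩
  have hfac : (inv m' ≫ pullback.fst (m ≫ f) g) ≫ m = pullback.fst f g := by
    rw [Category.assoc, IsIso.inv_comp_eq, pullback.lift_fst]
  have : StrongEpi ((inv m' ≫ pullback.fst (m ≫ f) g) ≫ m) := by rw [hfac]; infer_instance
  have : StrongEpi m := strongEpi_of_strongEpi (inv m' ≫ pullback.fst (m ≫ f) g) m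
  exact isIso_of_mono_of_strongEpi m

/-- In a semi-abelian category, the middle component of a morphism of short exact sequences is a
regular epimorphism as soon as the outer components are. -/
theorem SemiAbelian.isRegularEpi_middle {K' X' K X Y : C} {k' : K' ⟶ X'} {k : K ⟶ X}
    {f : X ⟶ Y} {u : K' ⟶ K} {v : X' ⟶ X} (hk : IsKernelOf k f) (hleft : k' ≫ v = u ≫ k)
    [IsRegularEpi u] [IsRegularEpi (v ≫ f)] : IsRegularEpi v := by
  have := SemiAbelian.regular (C := C)
  let F := Regular.strongEpiMonoFactorisation v
  have sq : CommSq (k' ≫ F.e) u F.m k := ⟨by simp [hleft]⟩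
  have : IsRegularEpi (F.e ≫ F.m ≫ f) := by rw [F.fac_assoc]; infer_instance
  have : IsIso F.m :=
    SemiAbelian.isIso_of_mono_of_kernel_factors hk F.m sq.lift sq.fac_right F.e
  have : IsRegularEpi F.e := inferInstanceAs
    (IsRegularEpi (Regular.strongEpiMonoFactorisation v).e)
  exact ⟨⟨RegularEpi.ofArrowIso (Arrow.isoMk (f := .mk F.e) (g := .mk v) (Iso.refl _)
    (asIso F.m)) (IsRegularEpi.getStruct _)⟩⟩

end Helpers

/-- In a semi-abelian category, given a morphism of short exact sequences,
if `w` is an isomorphism and `u` is a regular epimorphism, then the left-hand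
square is a pushout. -/
theorem statement3 {C : Type u} [Category.{v} C] [HasZeroMorphisms C] [HasZeroObject C]
    [HasFiniteLimits C] [HasBinaryCoproducts C] [SemiAbelian C]
    {K' X' Y' K X Y : C}
    (k' : K' ⟶ X') (f' : X' ⟶ Y') (k : K ⟶ X) (f : X ⟶ Y)
    (u : K' ⟶ K) (v : X' ⟶ X) (w : Y' ⟶ Y)
    (hk' : IsKernelOf k' f') (hf' : Nonempty (RegularEpi f'))
    (hk : IsKernelOf k f) (hf : Nonempty (RegularEpi f))
    (hleft : k' ≫ v = u ≫ k) (hright : f' ≫ w = v ≫ f)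
    (hw : IsIso w) (hu : Nonempty (RegularEpi u)) :
    IsPushout k' u v k := by
  have : IsRegularEpi u := ⟨hu⟩
  have : IsRegularEpi (v ≫ f) := by
    obtain ⟨hf'⟩ := hf'
    exact ⟨⟨RegularEpi.ofArrowIso (Arrow.isoMk (f := .mk f') (g := .mk (v ≫ f)) (Iso.refl _)
      (asIso w) (by simp [hright])) hf'⟩⟩
  have : IsRegularEpi v := SemiAbelian.isRegularEpi_middle hk hleft
  have : Mono k := hk.mono
  have hdesc (s : PushoutCocone k' u) : ∃ t : X ⟶ s.pt, v ≫ t = s.inl := by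
    refine SemiAbelian.exists_desc v s.inl ?_
    obtain ⟨n, hn⟩ := hk'.exists_lift (kernel.ι v) (by
      rw [← cancel_mono w, Category.assoc, hright, kernel.condition_assoc, zero_comp, zero_comp])
    have hnu : n ≫ u = 0 := by
      rw [← cancel_mono k, Category.assoc, ← hleft, reassoc_of% hn, kernel.condition, zero_comp]
    rw [← hn, Category.assoc, s.condition, reassoc_of% hnu, zero_comp]
  choose t ht using hdesc
  refine ⟨⟨hleft⟩, ⟨PushoutCocone.IsColimit.mk hleft t ht (fun s => ?_) fun s m hm _ => ?_⟩⟩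
  · rw [← cancel_epi u, ← reassoc_of% hleft, ht, s.condition]
  · rw [← cancel_epi v, hm, ht]
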